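/- For each n, the n-linear multiplication map Aₙ : 𝕂ⁿ → 𝕂, Aₙ(x₁,…,xₙ) = x₁⋯xₙ, is everywhere almost (p,…,p)-summing and ‖Aₙ‖_{al,p}^{ev} = 1. -/

import Mathlib

open Filter MeasureTheory Topology

noncomputable def rademacher (j : ℕ) (t : ℝ) : ℝ := (-1 : ℝ) ^ ⌊t * 2 ^ (j + 1)⌋

noncomputable def radSum {F : Type*} [NormedAddCommGroup F] [NormedSpace ℝ F]
    (x : ℕ → F) (m : ℕ) (t : ℝ) : F :=
  ∑ j ∈ Finset.range m, rademacher j t • x j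

/-- Membership in `Rad(F)`: the partial sums of `∑ rⱼ(·) xⱼ` converge in `L₂([0,1];F)`. -/
def RadMem {F : Type*} [NormedAddCommGroup F] [NormedSpace ℝ F] (x : ℕ → F) : Prop :=
  ∃ S : ℝ → F,
    Tendsto (fun m => ∫ t in (0:ℝ)..1, ‖radSum x m t - S t‖ ^ 2) atTop (nhds 0)

/-- The `Rad(F)` norm: `(∫₀¹ ‖∑_{j=1}^∞ rⱼ(t) xⱼ‖² dt)^{1/2}`, as the limit of the
corresponding quantities for the partial sums. -/
noncomputable def RadNorm {F : Type*} [NormedAddCommGroup F] [NormedSpace ℝ F]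
    (x : ℕ → F) : ℝ :=
  limUnder atTop (fun m => (∫ t in (0:ℝ)..1, ‖radSum x m t‖ ^ 2) ^ ((1:ℝ)/2))

/-- The weak-`p` norm of the first `m` terms of a sequence. -/
noncomputable def weakNormFin {E : Type*} [NormedAddCommGroup E] [NormedSpace ℝ E]
    (p : ℝ) (x : ℕ → E) (m : ℕ) : ℝ :=
  ⨆ φ : {φ : E →L[ℝ] ℝ // ‖φ‖ ≤ 1},
    (∑ j ∈ Finset.range m, |φ.1 (x j)| ^ p) ^ (1/p)

/-- The weak-`p` norm of a sequence. -/
noncomputable def weakNorm {E : Type*} [NormedAddCommGroup E] [NormedSpace ℝ E]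
    (p : ℝ) (x : ℕ → E) : ℝ :=
  ⨆ φ : {φ : E →L[ℝ] ℝ // ‖φ‖ ≤ 1}, (∑' j, |φ.1 (x j)| ^ p) ^ (1/p)

/-- Membership in `ℓ_p^u(E)`: weakly `p`-summable with tails tending to zero in weak-`p` norm. -/
def MemLpU {E : Type*} [NormedAddCommGroup E] [NormedSpace ℝ E]
    (p : ℝ) (x : ℕ → E) : Prop :=
  (∀ φ : E →L[ℝ] ℝ, Summable fun j => |φ (x j)| ^ p) ∧
    Tendsto (fun m => weakNorm p fun j => x (j + m)) atTop (nhds 0)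

/-- `T` is almost `(p,…,p)`-summing at the point `a`. -/
def AlmostSummingAt {n : ℕ} {E : Fin n → Type*} [∀ i, NormedAddCommGroup (E i)]
    [∀ i, NormedSpace ℝ (E i)] {F : Type*} [NormedAddCommGroup F] [NormedSpace ℝ F]
    (p : ℝ) (T : ContinuousMultilinearMap ℝ E F) (a : ∀ i, E i) : Prop :=
  ∀ x : ∀ i, ℕ → E i, (∀ i, MemLpU p (x i)) →
    RadMem (fun j => T (fun i => a i + x i j) - T a)

/-- `T` is everywhere almost `(p,…,p)`-summing. -/
def EvAlmostSumming {n : ℕ} {E : Fin n → Type*} [∀ i, NormedAddCommGroup (E i)]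
    [∀ i, NormedSpace ℝ (E i)] {F : Type*} [NormedAddCommGroup F] [NormedSpace ℝ F]
    (p : ℝ) (T : ContinuousMultilinearMap ℝ E F) : Prop :=
  ∀ a : ∀ i, E i, AlmostSummingAt p T a

/-- The norm `‖T‖_{al,p}^{ev}`: the best constant in the finite characterization. -/
noncomputable def evNorm {n : ℕ} {E : Fin n → Type*} [∀ i, NormedAddCommGroup (E i)]
    [∀ i, NormedSpace ℝ (E i)] {F : Type*} [NormedAddCommGroup F] [NormedSpace ℝ F]
    (p : ℝ) (T : ContinuousMultilinearMap ℝ E F) : ℝ :=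
  sInf {C : ℝ | 0 ≤ C ∧ ∀ (m : ℕ) (a : ∀ i, E i) (x : ∀ i, ℕ → E i),
    (∫ t in (0:ℝ)..1,
        ‖radSum (fun j => T (fun i => a i + x i j) - T a) m t‖ ^ 2) ^ ((1:ℝ)/2)
      ≤ C * ∏ i, (‖a i‖ + weakNormFin p (x i) m)}

/-- A linear operator is almost `p`-summing. -/
def LinAlmostSumming {E F : Type*} [NormedAddCommGroup E] [NormedSpace ℝ E]
    [NormedAddCommGroup F] [NormedSpace ℝ F] (p : ℝ) (u : E →L[ℝ] F) : Prop :=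
  ∀ x : ℕ → E, MemLpU p x → RadMem fun j => u (x j)

/-- The almost `p`-summing norm of a linear operator. -/
noncomputable def linNorm {E F : Type*} [NormedAddCommGroup E] [NormedSpace ℝ E]
    [NormedAddCommGroup F] [NormedSpace ℝ F] (p : ℝ) (u : E →L[ℝ] F) : ℝ :=
  sInf {C : ℝ | 0 ≤ C ∧ ∀ (m : ℕ) (x : ℕ → E),
    (∫ t in (0:ℝ)..1, ‖radSum (fun j => u (x j)) m t‖ ^ 2) ^ ((1:ℝ)/2)
      ≤ C * weakNormFin p x m}



lemma rademacher_abs (j : ℕ) (t : ℝ) : |rademacher j t| = 1 := by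
  unfold rademacher
  simp [abs_zpow]

lemma rademacher_sq (j : ℕ) (t : ℝ) : rademacher j t * rademacher j t = 1 := by
  rw [← abs_mul_abs_self, rademacher_abs, one_mul]

lemma rademacher_measurable (j : ℕ) : Measurable (rademacher j) := by
  unfold rademacher
  exact (measurable_of_countable (fun k : ℤ => (-1 : ℝ) ^ k)).comp
    (Int.measurable_floor.comp (measurable_id.mul_const _))

/-- Shift by `k / 2^(j+1)`. -/
lemma rademacher_shift (j : ℕ) (s : ℝ) (k : ℤ) (h : s * 2 ^ (j + 1) = k) (t : ℝ) :
    rademacher j (t + s) = (-1 : ℝ) ^ k * rademacher j t := by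
  unfold rademacher
  rw [add_mul, h, Int.floor_add_intCast, zpow_add₀ (by norm_num), mul_comm]

lemma rademacher_periodic (j : ℕ) : Function.Periodic (rademacher j) 1 := by
  intro t
  rw [rademacher_shift j 1 (2 ^ (j + 1)) (by push_cast; ring) t]
  have : Even ((2 : ℤ) ^ (j + 1)) := by
    rw [pow_succ]; exact even_two.mul_left _
  rw [this.neg_one_zpow, one_mul]

lemma rademacher_orth_lt {i j : ℕ} (h : i < j) :
    ∫ t in (0:ℝ)..1, rademacher i t * rademacher j t = 0 := by
  obtain ⟨k, rfl⟩ := Nat.exists_eq_add_of_lt h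
  set g : ℝ → ℝ := fun t => rademacher i t * rademacher (i + k + 1) t with hg
  have hper : Function.Periodic g 1 := (rademacher_periodic i).mul (rademacher_periodic _)
  set s : ℝ := (2 ^ (i + 1))⁻¹ with hs
  have hsh : ∀ t, g (t + s) = - g t := by
    intro t
    simp only [hg]
    rw [rademacher_shift i s 1 (by rw [hs]; field_simp; norm_num),
      rademacher_shift (i + k + 1) s (2 ^ (k + 1)) ?_]
    · have : Even ((2 : ℤ) ^ (k + 1)) := by
        rw [pow_succ]; exact even_two.mul_left _
      rw [this.neg_one_zpow]
      simp
    · rw [hs]; push_cast; field_simp; ring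
  have h1 : ∫ t in (0:ℝ)..1, g (t + s) = ∫ t in (0:ℝ)..1, g t := by
    rw [intervalIntegral.integral_comp_add_right]
    have := hper.intervalIntegral_add_eq (0 + s) 0
    rw [zero_add] at this
    rw [zero_add, add_comm 1 s, this, zero_add]
  simp only [hsh, intervalIntegral.integral_neg] at h1
  change ∫ t in (0:ℝ)..1, g t = 0
  linarith

lemma rademacher_orth (i j : ℕ) :
    ∫ t in (0:ℝ)..1, rademacher i t * rademacher j t = if i = j then 1 else 0 := by
  rcases lt_trichotomy i j with h | h | h
  · rw [rademacher_orth_lt h, if_neg h.ne]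
  · subst h; simp [rademacher_sq]
  · rw [if_neg h.ne']
    simpa only [mul_comm] using rademacher_orth_lt h

noncomputable abbrev unitMeas : Measure ℝ := volume.restrict (Set.Ioc 0 1)

lemma rademacher_memLp (j : ℕ) : MemLp (rademacher j) 2 unitMeas :=
  MemLp.of_bound (rademacher_measurable j).aestronglyMeasurable 1
    (Filter.Eventually.of_forall fun t => by rw [Real.norm_eq_abs, rademacher_abs])

noncomputable def radLp (j : ℕ) : Lp ℝ 2 unitMeas := (rademacher_memLp j).toLp

lemma sq_norm_Lp (f : ℝ → ℝ) (F : Lp ℝ 2 unitMeas) (h : F =ᵐ[unitMeas] f) :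
    ∫ t in (0:ℝ)..1, ‖f t‖ ^ 2 = ‖F‖ ^ 2 := by
  rw [← real_inner_self_eq_norm_sq, L2.inner_def,
    intervalIntegral.integral_of_le zero_le_one]
  refine integral_congr_ae ?_
  filter_upwards [h] with t ht
  rw [ht, real_inner_self_eq_norm_sq]

lemma radLp_orthonormal : Orthonormal ℝ radLp := by
  classical
  rw [orthonormal_iff_ite]
  intro i j
  rw [L2.inner_def, ← rademacher_orth i j, intervalIntegral.integral_of_le zero_le_one]
  refine integral_congr_ae ?_
  filter_upwards [(rademacher_memLp i).coeFn_toLp, (rademacher_memLp j).coeFn_toLp] with t hi hj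
  simp only [radLp, hi, hj]
  simp [mul_comm]

lemma radLp_sum (c : ℕ → ℝ) (m : ℕ) :
    (∑ j ∈ Finset.range m, c j • radLp j : Lp ℝ 2 unitMeas) =ᵐ[unitMeas] radSum c m := by
  induction m with
  | zero =>
    simp only [Finset.range_zero, Finset.sum_empty]
    filter_upwards [Lp.coeFn_zero ℝ 2 unitMeas] with t ht
    rw [ht]; simp [radSum]
  | succ m ih =>
    rw [Finset.sum_range_succ]
    filter_upwards [ih, Lp.coeFn_add (∑ j ∈ Finset.range m, c j • radLp j) (c m • radLp m),
      Lp.coeFn_smul (c m) (radLp m), (rademacher_memLp m).coeFn_toLp] with t h1 h2 h3 h4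
    rw [h2, Pi.add_apply, h1, h3, Pi.smul_apply]
    simp only [radLp, h4, radSum, Finset.sum_range_succ, smul_eq_mul, mul_comm]

lemma radSum_sq (c : ℕ → ℝ) (m : ℕ) :
    ∫ t in (0:ℝ)..1, ‖radSum c m t‖ ^ 2 = ∑ j ∈ Finset.range m, c j ^ 2 := by
  rw [sq_norm_Lp _ _ (radLp_sum c m)]
  have := radLp_orthonormal.orthogonalFamily.norm_sum c (Finset.range m)
  simpa using this

lemma radMem_of_summable (c : ℕ → ℝ) (h : Summable fun j => c j ^ 2) : RadMem c := by
  have hs : Summable fun j => c j • radLp j := by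
    have := (radLp_orthonormal.orthogonalFamily.summable_iff_norm_sq_summable c).2
      (by simpa using h)
    simpa using this
  obtain ⟨S, hS⟩ := hs
  refine ⟨S, ?_⟩
  have h1 := hS.tendsto_sum_nat
  have h2 := (tendsto_iff_norm_sub_tendsto_zero.1 h1).pow 2
  rw [zero_pow two_ne_zero] at h2
  refine h2.congr fun m => ?_
  refine (sq_norm_Lp (fun t => radSum c m t - S t) _ ?_).symm
  filter_upwards [radLp_sum c m, Lp.coeFn_sub (∑ j ∈ Finset.range m, c j • radLp j) S] with t a b
  rw [b, Pi.sub_apply, a]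

/-- The `ℓ_p` norm of the first `m` terms. -/
noncomputable def lpn (p : ℝ) (m : ℕ) (f : ℕ → ℝ) : ℝ :=
  (∑ j ∈ Finset.range m, |f j| ^ p) ^ (1/p)

lemma lpn_sum_nonneg (p : ℝ) (m : ℕ) (f : ℕ → ℝ) : 0 ≤ ∑ j ∈ Finset.range m, |f j| ^ p :=
  Finset.sum_nonneg fun _ _ => Real.rpow_nonneg (abs_nonneg _) _

lemma lpn_nonneg (p : ℝ) (m : ℕ) (f : ℕ → ℝ) : 0 ≤ lpn p m f :=
  Real.rpow_nonneg (lpn_sum_nonneg p m f) _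

lemma lpn_mul_le {p : ℝ} (hp : 1 < p) (m : ℕ) (f g : ℕ → ℝ) (K : ℝ) (hK : 0 ≤ K)
    (h : ∀ j < m, |f j| ≤ K) : lpn p m (fun j => f j * g j) ≤ K * lpn p m g := by
  have hp0 : 0 < p := by linarith
  have : K * lpn p m g = (K ^ p * ∑ j ∈ Finset.range m, |g j| ^ p) ^ (1/p) := by
    rw [Real.mul_rpow (Real.rpow_nonneg hK _) (lpn_sum_nonneg p m g), ← Real.rpow_mul hK,
      mul_one_div_cancel hp0.ne', Real.rpow_one, lpn]
  rw [this, lpn]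
  refine Real.rpow_le_rpow (lpn_sum_nonneg p m _) ?_ (by positivity)
  rw [Finset.mul_sum]
  refine Finset.sum_le_sum fun j hj => ?_
  rw [abs_mul, Real.mul_rpow (abs_nonneg _) (abs_nonneg _)]
  gcongr
  exact h j (Finset.mem_range.1 hj)

lemma abs_le_lpn {p : ℝ} (hp : 1 < p) (m : ℕ) (f : ℕ → ℝ) (j : ℕ) (hj : j < m) :
    |f j| ≤ lpn p m f := by
  have hp0 : 0 < p := by linarith
  have h1 : |f j| = (|f j| ^ p) ^ (1/p) := by
    rw [← Real.rpow_mul (abs_nonneg _), mul_one_div_cancel hp0.ne', Real.rpow_one]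
  rw [h1, lpn]
  refine Real.rpow_le_rpow (by positivity) ?_ (by positivity)
  exact Finset.single_le_sum (f := fun j => |f j| ^ p)
    (fun i _ => Real.rpow_nonneg (abs_nonneg (f i)) p) (Finset.mem_range.2 hj)

lemma lpn_pow {p : ℝ} (hp : 1 < p) (m : ℕ) (f : ℕ → ℝ) :
    lpn p m f ^ p = ∑ j ∈ Finset.range m, |f j| ^ p := by
  have hp0 : 0 < p := by linarith
  rw [lpn, ← Real.rpow_mul (lpn_sum_nonneg p m f), one_div_mul_cancel hp0.ne', Real.rpow_one]

lemma sum_sq_le {p : ℝ} (hp : 1 < p) (hp2 : p ≤ 2) (m : ℕ) (f : ℕ → ℝ) :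
    ∑ j ∈ Finset.range m, f j ^ 2 ≤ lpn p m f ^ 2 := by
  have key : ∀ y : ℝ, 0 ≤ y → y ^ 2 = y ^ p * y ^ (2 - p) := by
    intro y hy
    rw [← Real.rpow_add_of_nonneg hy (by linarith) (by linarith)]
    norm_num
  rw [key _ (lpn_nonneg p m f), lpn_pow hp, Finset.sum_mul]
  refine Finset.sum_le_sum fun j hj => ?_
  rw [← sq_abs, key _ (abs_nonneg _)]
  gcongr
  exact abs_le_lpn hp m f j (Finset.mem_range.1 hj)

lemma lpn_prod_le {p : ℝ} (hp : 1 < p) (m : ℕ) {ι : Type*} (s : Finset ι) (a : ι → ℝ)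
    (x : ι → ℕ → ℝ) :
    lpn p m (fun j => ∏ i ∈ s, (a i + x i j) - ∏ i ∈ s, a i) ≤
      ∏ i ∈ s, (|a i| + lpn p m (x i)) - ∏ i ∈ s, |a i| := by
  classical
  have hp0 : 0 < p := by linarith
  induction s using Finset.induction_on with
  | empty => simp [lpn, Real.zero_rpow hp0.ne', Real.zero_rpow (inv_pos.2 hp0).ne']
  | insert k s hk ih =>
    simp only [Finset.prod_insert hk]
    set A := ∏ i ∈ s, a i with hA
    set c : ℕ → ℝ := fun j => ∏ i ∈ s, (a i + x i j) - A with hc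
    set P := ∏ i ∈ s, (|a i| + lpn p m (x i))
    have hAabs : ∏ i ∈ s, |a i| = |A| := (Finset.abs_prod _ _).symm
    rw [hAabs] at ih ⊢
    have e : (fun j => (a k + x k j) * ∏ i ∈ s, (a i + x i j) - a k * A)
        = fun j => (a k + x k j) * c j + A * x k j := by
      funext j; simp only [hc]; ring
    rw [e]
    have hn := lpn_nonneg p m (x k)
    have h1 : lpn p m (fun j => (a k + x k j) * c j) ≤ (|a k| + lpn p m (x k)) * lpn p m c := by
      refine lpn_mul_le hp m _ _ _ (by positivity) fun j hj => ?_
      exact (abs_add_le _ _).trans (by gcongr; exact abs_le_lpn hp m _ j hj)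
    have h2 : lpn p m (fun j => A * x k j) ≤ |A| * lpn p m (x k) :=
      lpn_mul_le hp m (fun _ => A) _ _ (abs_nonneg _) fun _ _ => le_rfl
    have h3 := Real.Lp_add_le (Finset.range m) (fun j => (a k + x k j) * c j)
      (fun j => A * x k j) hp.le
    have h4 : (|a k| + lpn p m (x k)) * lpn p m c ≤ (|a k| + lpn p m (x k)) * (P - |A|) := by
      gcongr
    change lpn p m _ ≤ lpn p m _ + lpn p m _ at h3
    nlinarith

lemma weakNormFin_real {p : ℝ} (hp : 1 < p) (m : ℕ) (f : ℕ → ℝ) :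
    weakNormFin p f m = lpn p m f := by
  have hle : ∀ φ : {φ : ℝ →L[ℝ] ℝ // ‖φ‖ ≤ 1},
      (∑ j ∈ Finset.range m, |φ.1 (f j)| ^ p) ^ (1/p) ≤ lpn p m f := by
    intro φ
    refine Real.rpow_le_rpow (lpn_sum_nonneg p m _) ?_ (by positivity)
    refine Finset.sum_le_sum fun j _ => ?_
    refine Real.rpow_le_rpow (abs_nonneg _) ?_ (by linarith)
    simpa using φ.1.le_of_opNorm_le φ.2 (f j)
  have : Nonempty {φ : ℝ →L[ℝ] ℝ // ‖φ‖ ≤ 1} := ⟨⟨0, by simp⟩⟩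
  refine le_antisymm (ciSup_le hle) ?_
  exact le_ciSup (f := fun φ : {φ : ℝ →L[ℝ] ℝ // ‖φ‖ ≤ 1} =>
    (∑ j ∈ Finset.range m, |φ.1 (f j)| ^ p) ^ (1/p)) ⟨_, by rintro _ ⟨φ, rfl⟩; exact hle φ⟩
    ⟨ContinuousLinearMap.id ℝ ℝ, ContinuousLinearMap.norm_id_le⟩

lemma lpn_le_prod {p : ℝ} (hp : 1 < p) (m n : ℕ) (a : Fin n → ℝ) (x : Fin n → ℕ → ℝ) :
    lpn p m (fun j => ∏ i, (a i + x i j) - ∏ i, a i) ≤ ∏ i, (|a i| + lpn p m (x i)) :=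
  (lpn_prod_le hp m Finset.univ a x).trans
    (sub_le_self _ (Finset.prod_nonneg fun _ _ => abs_nonneg _))

theorem evNorm_multiplication (p : ℝ) (hp1 : 1 < p) (hp2 : p ≤ 2)
    (n : ℕ) (hn : 0 < n) :
    EvAlmostSumming p (ContinuousMultilinearMap.mkPiAlgebra ℝ (Fin n) ℝ) ∧
      evNorm p (ContinuousMultilinearMap.mkPiAlgebra ℝ (Fin n) ℝ) = 1 := by
  constructor
  · intro a x hx
    refine radMem_of_summable _ ?_
    simp only [ContinuousMultilinearMap.mkPiAlgebra_apply]
    have hsum : ∀ i, Summable fun j => |x i j| ^ p := fun i => by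
      simpa using (hx i).1 (ContinuousLinearMap.id ℝ ℝ)
    have hb : ∀ i m, lpn p m (x i) ≤ (∑' j, |x i j| ^ p) ^ (1/p) := fun i m =>
      Real.rpow_le_rpow (lpn_sum_nonneg p m _)
        ((hsum i).sum_le_tsum _ fun _ _ => Real.rpow_nonneg (abs_nonneg _) _) (by positivity)
    refine summable_of_sum_range_le
      (c := (∏ i, (|a i| + (∑' j, |x i j| ^ p) ^ (1/p))) ^ 2) (fun _ => sq_nonneg _) fun m => ?_
    refine (sum_sq_le hp1 hp2 m _).trans ?_
    refine pow_le_pow_left₀ (lpn_nonneg _ _ _) ((lpn_le_prod hp1 m n a x).trans ?_) 2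
    exact Finset.prod_le_prod (fun i _ => add_nonneg (abs_nonneg _) (lpn_nonneg _ _ _))
      fun i _ => by gcongr; exact hb i m
  · unfold evNorm
    refine IsLeast.csInf_eq ⟨⟨zero_le_one, fun m a x => ?_⟩, ?_⟩
    · rw [radSum_sq]
      simp only [ContinuousMultilinearMap.mkPiAlgebra_apply, one_mul, weakNormFin_real hp1,
        Real.norm_eq_abs]
      rw [← Real.sqrt_eq_rpow]
      exact (Real.sqrt_le_left (lpn_nonneg _ _ _)).2 (sum_sq_le hp1 hp2 m _) |>.trans
        (lpn_le_prod hp1 m n a x)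
    · rintro C ⟨_, hC⟩
      have := hC 1 (fun _ => 0) (fun _ _ => 1)
      rw [radSum_sq] at this
      simpa [weakNormFin_real hp1, lpn, hn.ne'] using this
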